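/- arXiv:1304.4948 — 7 statements merged into one kernel-verified Lean document; each statement's English description precedes it below -/
import Mathlib

section
/- Let U be a finite set with |U| = n, and let f : 2^U → ℝ be a non-negative submodular function with f(∅) = f(U) = 0. For each ordered pair (u, v) ∈ U × U with u ≠ v, define w(u, v) = min{ f(R) : R ⊆ U, u ∈ R, v ∉ R }. Then for every S ⊆ U, f(S) ≤ Σ_{u ∈ S, v ∈ U \ S} w(u, v) ≤ (n²/4)·f(S). In particular, the directed cut function with weights w approximates f within a factor n²/4. -/
/-- Let `f` be a non-negative submodular function on a finite ground set of size `n`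
with `f(∅) = f(U) = 0`.  For `u ≠ v` let `w u v` be the minimum of `f(R)` over all
sets `R` containing `u` but not `v`.  Then for every `S`,
`f(S) ≤ ∑_{u ∈ S, v ∉ S} w u v ≤ (n²/4)·f(S)`, i.e. the directed cut function with
weights `w` approximates `f` within a factor `n²/4`. -/
theorem submodular_approx_by_directed_cut {α : Type*} [Fintype α] [DecidableEq α]
    (f : Finset α → ℝ)
    (hnonneg : ∀ S : Finset α, 0 ≤ f S)
    (hsubmod : ∀ S T : Finset α, f (S ∪ T) + f (S ∩ T) ≤ f S + f T)
    (hempty : f ∅ = 0) (huniv : f Finset.univ = 0)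
    (w : α → α → ℝ)
    (hw : ∀ u v : α, u ≠ v →
      IsLeast (f '' {R : Finset α | u ∈ R ∧ v ∉ R}) (w u v))
    (S : Finset α) :
    f S ≤ (∑ u ∈ S, ∑ v ∈ Sᶜ, w u v) ∧
      (∑ u ∈ S, ∑ v ∈ Sᶜ, w u v) ≤ ((Fintype.card α : ℝ) ^ 2 / 4) * f S := by
  have hchoose : ∀ u v : α, ∃ R : Finset α, u ≠ v → (u ∈ R ∧ v ∉ R) ∧ f R = w u v := by
    intro u v
    by_cases h : u = v
    · exact ⟨∅, fun h' => absurd h h'⟩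
    · obtain ⟨R, hR, hfR⟩ := (hw u v h).1
      exact ⟨R, fun _ => ⟨hR, hfR⟩⟩
  choose R hR using hchoose
  have hinf : ∀ (T : Finset α) (g : α → Finset α), f (T.inf g) ≤ ∑ v ∈ T, f (g v) := by
    intro T g
    induction T using Finset.induction_on with
    | empty => simp [huniv]
    | insert a T ha ih =>
      rw [Finset.inf_insert, Finset.sum_insert ha, Finset.inf_eq_inter]
      linarith [hsubmod (g a) (T.inf g), hnonneg (g a ∪ T.inf g)]
  have hsup : ∀ (T : Finset α) (g : α → Finset α), f (T.sup g) ≤ ∑ v ∈ T, f (g v) := by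
    intro T g
    induction T using Finset.induction_on with
    | empty => simp [hempty]
    | insert a T ha ih =>
      rw [Finset.sup_insert, Finset.sum_insert ha, Finset.sup_eq_union]
      linarith [hsubmod (g a) (T.sup g), hnonneg (g a ∩ T.sup g)]
  have hne : ∀ u ∈ S, ∀ v ∈ Sᶜ, u ≠ v := by
    rintro u hu v hv rfl
    exact (Finset.mem_compl.1 hv) hu
  constructor
  · have hS : S = S.sup (fun u => Sᶜ.inf (fun v => R u v)) := by
      apply le_antisymm
      · intro u hu
        rw [Finset.mem_sup]
        refine ⟨u, hu, ?_⟩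
        rw [← Finset.singleton_subset_iff]
        refine Finset.le_inf fun v hv => ?_
        exact Finset.singleton_subset_iff.2 (hR u v (hne u hu v hv)).1.1
      · refine Finset.sup_le fun u hu => ?_
        intro x hx
        by_contra hxS
        have hxc := Finset.mem_compl.2 hxS
        have hle : Sᶜ.inf (fun v => R u v) ≤ R u x := Finset.inf_le hxc
        exact (hR u x (hne u hu x hxc)).1.2 (hle hx)
    calc f S = f (S.sup (fun u => Sᶜ.inf (fun v => R u v))) := congrArg f hS
      _ ≤ ∑ u ∈ S, f (Sᶜ.inf (fun v => R u v)) := hsup _ _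
      _ ≤ ∑ u ∈ S, ∑ v ∈ Sᶜ, f (R u v) := Finset.sum_le_sum fun u _ => hinf _ _
      _ = ∑ u ∈ S, ∑ v ∈ Sᶜ, w u v :=
        Finset.sum_congr rfl fun u hu => Finset.sum_congr rfl fun v hv =>
          (hR u v (hne u hu v hv)).2
  · have h1 : (∑ u ∈ S, ∑ v ∈ Sᶜ, w u v) ≤ ∑ u ∈ S, ∑ v ∈ Sᶜ, f S :=
      Finset.sum_le_sum fun u hu => Finset.sum_le_sum fun v hv =>
        (hw u v (hne u hu v hv)).2 ⟨S, ⟨hu, Finset.mem_compl.1 hv⟩, rfl⟩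
    have hcard : (S.card : ℝ) + (Sᶜ.card : ℝ) = (Fintype.card α : ℝ) := by
      exact_mod_cast Finset.card_add_card_compl S
    refine h1.trans ?_
    simp only [Finset.sum_const, nsmul_eq_mul]
    rw [← mul_assoc, ← hcard]
    refine mul_le_mul_of_nonneg_right ?_ (hnonneg S)
    nlinarith [sq_nonneg ((S.card : ℝ) - (Sᶜ.card : ℝ))]
end

section
/- Let U be a finite set with |U| = n ≥ 1, and let f : 2^U → ℝ be a non-negative symmetric submodular function with f(∅) = 0. Then there exists a symmetric non-negative weight function w : U × U → ℝ (w(u,v) = w(v,u) ≥ 0) such that for every S ⊆ U, f(S) ≤ Σ_{u ∈ S, v ∈ U \ S} w(u, v) ≤ (n − 1)·f(S). That is, undirected cut functions (n−1)-approximate every such f. -/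
/-- `K` is the cut function of some symmetric non-negative weights. -/
def IsCutFn {α : Type*} [Fintype α] [DecidableEq α] (K : Finset α → ℝ) : Prop :=
  ∃ w : α → α → ℝ, (∀ u v : α, 0 ≤ w u v) ∧ (∀ u v : α, w u v = w v u) ∧
    ∀ S : Finset α, K S = ∑ u ∈ S, ∑ v ∈ Sᶜ, w u v

theorem IsCutFn.add_fn {α : Type*} [Fintype α] [DecidableEq α] {K L : Finset α → ℝ}
    (hK : IsCutFn K) (hL : IsCutFn L) : IsCutFn (fun S => K S + L S) := by
  obtain ⟨w, h1, h2, h3⟩ := hK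
  obtain ⟨w', h1', h2', h3'⟩ := hL
  refine ⟨fun u v => w u v + w' u v, fun u v => add_nonneg (h1 u v) (h1' u v), fun u v => ?_,
    fun S => ?_⟩
  · simp only [h2 u v, h2' u v]
  · simp only [h3, h3', Finset.sum_add_distrib]

theorem IsCutFn.compl_eq {α : Type*} [Fintype α] [DecidableEq α] {K : Finset α → ℝ}
    (hK : IsCutFn K) (S : Finset α) : K Sᶜ = K S := by
  obtain ⟨w, h1, h2, h3⟩ := hK
  rw [h3, h3, Finset.sum_comm, compl_compl]
  exact Finset.sum_congr rfl fun u _ => Finset.sum_congr rfl fun v _ => h2 _ _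

theorem isCutFn_edge {α : Type*} [Fintype α] [DecidableEq α] (a b : α) (m : ℝ) (hm : 0 ≤ m) :
    IsCutFn (fun S : Finset α =>
      (if a ∈ S ∧ b ∉ S then m else 0) + (if b ∈ S ∧ a ∉ S then m else 0)) := by
  refine ⟨fun u v => (if u = a then if v = b then m else 0 else 0)
    + (if u = b then if v = a then m else 0 else 0), fun u v => ?_, fun u v => ?_, fun S => ?_⟩
  · positivity
  · dsimp only; split_ifs <;> simp_all
  · have key : ∀ x y : α, ∑ u ∈ S, ∑ v ∈ Sᶜ, (if u = x then if v = y then m else 0 else 0)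
        = if x ∈ S ∧ y ∉ S then m else 0 := by
      intro x y
      have : ∀ u ∈ S, ∑ v ∈ Sᶜ, (if u = x then if v = y then m else 0 else 0)
          = if u = x then (if y ∈ Sᶜ then m else 0) else 0 := by
        intro u _
        split_ifs <;> simp_all
      rw [Finset.sum_congr rfl this, Finset.sum_ite_eq']
      simp only [Finset.mem_compl, ite_and]
    simp only [Finset.sum_add_distrib, key]

/-- Gomory-Hu type induction. -/
theorem cut_tree_aux {α : Type*} [Fintype α] [DecidableEq α] (n : ℕ) :
    ∀ (R : Finset α), R.card = n → R.Nonempty → ∀ f : Finset α → ℝ,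
    (∀ S : Finset α, 0 ≤ f S) →
    (∀ S T : Finset α, f (S ∪ T) + f (S ∩ T) ≤ f S + f T) →
    (∀ S : Finset α, f S = f Sᶜ) → f ∅ = 0 →
    ∃ (c : α → α) (K : Finset α → ℝ), IsCutFn K ∧ (∀ x, c x ∈ R) ∧ (∀ x ∈ R, c x = x) ∧
      (∀ S T : Finset α, (∀ x ∈ R, x ∈ S ↔ x ∈ T) → K S = K T) ∧
      (∀ S : Finset α, f (Finset.univ.filter fun x => c x ∈ S) ≤ K S) ∧
      (∀ S : Finset α, K S ≤ ((R.card : ℝ) - 1) * f S) := by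
  induction n using Nat.strong_induction_on with
  | _ n ih =>
  intro R hRn hR f hnn hsub hsym h0
  have hU : f Finset.univ = 0 := by rw [hsym]; simpa using h0
  by_cases hsep : ∃ W : Finset α, (∃ x ∈ R, x ∈ W) ∧ (∃ x ∈ R, x ∉ W)
  · -- minimal separating set
    obtain ⟨W, hW, hmin⟩ := Finset.exists_min_image
      (Finset.univ.filter fun W : Finset α => (∃ x ∈ R, x ∈ W) ∧ (∃ x ∈ R, x ∉ W)) f
      (by obtain ⟨W, hW⟩ := hsep; exact ⟨W, by simpa using hW⟩)
    simp only [Finset.mem_filter, Finset.mem_univ, true_and] at hW hmin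
    obtain ⟨⟨y0, hy0R, hy0⟩, ⟨x0, hx0R, hx0⟩⟩ := hW
    have hcap : ∀ S T, f (S ∩ T) ≤ f S + f T := fun S T => by
      linarith [hsub S T, hnn (S ∪ T)]
    have hcup : ∀ S T, f (S ∪ T) ≤ f S + f T := fun S T => by
      linarith [hsub S T, hnn (S ∩ T)]
    -- one-sided step
    have step : ∀ (W : Finset α) (x0 y0 : α), y0 ∈ R → y0 ∈ W → x0 ∈ R → x0 ∉ W →
        (∀ W' : Finset α, (∃ x ∈ R, x ∈ W') ∧ (∃ x ∈ R, x ∉ W') → f W ≤ f W') →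
        ∃ (c : α → α) (K : Finset α → ℝ), IsCutFn K ∧ (∀ x, c x ∈ R.filter (· ∈ W)) ∧
          (∀ x ∈ R.filter (· ∈ W), c x = x) ∧
          (∀ S T : Finset α, (∀ x ∈ R.filter (· ∈ W), x ∈ S ↔ x ∈ T) → K S = K T) ∧
          (∀ S : Finset α,
            f (Finset.univ.filter fun x => c (if x ∈ W then x else x0) ∈ S) ≤ K S) ∧
          (∀ S : Finset α, K S ≤ (((R.filter (· ∈ W)).card : ℝ) - 1) * f S) := by
      intro W x0 y0 hy0R hy0 hx0R hx0 hmin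
      have hne : (R.filter (· ∈ W)).Nonempty := ⟨y0, by simp [hy0R, hy0]⟩
      have hlt : (R.filter (· ∈ W)).card < n := by
        rw [← hRn]
        exact Finset.card_lt_card (Finset.filter_ssubset.2 ⟨x0, hx0R, hx0⟩)
      obtain ⟨c, K, hK, hc1, hc2, hdep, hlo, hup⟩ := ih _ hlt (R.filter (· ∈ W)) rfl hne
        (fun S => f (Finset.univ.filter fun x => (if x ∈ W then x else x0) ∈ S))
        (fun S => hnn _)
        (fun S T => by
          convert hsub (Finset.univ.filter fun x => (if x ∈ W then x else x0) ∈ S)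
            (Finset.univ.filter fun x => (if x ∈ W then x else x0) ∈ T) using 3
          · ext x; simp
          · ext x; simp)
        (fun S => by
          rw [hsym]
          congr 1
          ext x; simp)
        (by simpa using h0)
      refine ⟨c, K, hK, hc1, hc2, hdep, fun S => ?_, fun S => ?_⟩
      · simpa using hlo S
      · have hcard : (0:ℝ) ≤ ((R.filter (· ∈ W)).card : ℝ) - 1 := by
          have : 1 ≤ (R.filter (· ∈ W)).card := hne.card_pos
          have : (1:ℝ) ≤ ((R.filter (· ∈ W)).card : ℝ) := by exact_mod_cast this
          linarith
        have main : ∀ S : Finset α, (∃ x ∈ R, x ∉ W ∧ x ∉ S) →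
            K S ≤ (((R.filter (· ∈ W)).card : ℝ) - 1) * f S := by
          rintro S ⟨z, hzR, hzW, hzS⟩
          have h1 : f W ≤ f (S ∪ W) := hmin _
            ⟨⟨y0, hy0R, by simp [hy0]⟩, ⟨z, hzR, by simp [hzW, hzS]⟩⟩
          have h2 : f (S ∩ W) ≤ f S := by linarith [hsub S W]
          have h3 : K S = K (S ∩ W) := hdep _ _ (by
            intro x hx
            simp only [Finset.mem_filter] at hx
            simp [hx.2])
          have h4 := hup (S ∩ W)
          have h5 : (Finset.univ.filter fun x => (if x ∈ W then x else x0) ∈ S ∩ W) = S ∩ W := by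
            ext x
            by_cases hx : x ∈ W <;> simp [hx, hx0]
          simp only [h5] at h4
          rw [h3]
          exact h4.trans (mul_le_mul_of_nonneg_left h2 hcard)
        by_cases hx : x0 ∈ S
        · have := main Sᶜ ⟨x0, hx0R, hx0, by simpa using hx⟩
          rwa [hK.compl_eq, ← hsym] at this
        · exact main S ⟨x0, hx0R, hx0, hx⟩
    obtain ⟨c1, K1, hK1, hc1, hc1', hd1, hl1, hu1⟩ := step W x0 y0 hy0R hy0 hx0R hx0 hmin
    obtain ⟨c2, K2, hK2, hc2, hc2', hd2, hl2, hu2⟩ := step Wᶜ y0 x0 hx0R (by simpa using hx0)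
      hy0R (by simpa using hy0) (fun W' h => by rw [← hsym]; exact hmin W' h)
    have hr1 := hc1 x0
    have hr2 := hc2 y0
    simp only [Finset.mem_filter, Finset.mem_compl] at hc1 hc2 hc1' hc2' hd1 hd2 hr1 hr2
    refine ⟨fun x => if x ∈ W then c1 x else c2 x, _,
      (hK1.add_fn hK2).add_fn (isCutFn_edge (c1 x0) (c2 y0) (f W) (hnn W)), ?_, ?_, ?_, ?_, ?_⟩
    · intro x
      dsimp only
      split_ifs
      · exact (hc1 x).1
      · exact (hc2 x).1
    · intro x hx
      dsimp only
      split_ifs with h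
      · exact hc1' x ⟨hx, h⟩
      · exact hc2' x ⟨hx, h⟩
    · intro S T hST
      simp only [hd1 S T (fun x hx => hST x hx.1), hd2 S T (fun x hx => hST x hx.1),
        hST _ hr1.1, hST _ hr2.1]
    · intro S
      have a1 := hl1 S
      have a2 := hl2 S
      set X := Finset.univ.filter fun x => c1 (if x ∈ W then x else x0) ∈ S with hX
      set Y := Finset.univ.filter fun x => c2 (if x ∈ Wᶜ then x else y0) ∈ S with hY
      set Z := Finset.univ.filter fun x => (if x ∈ W then c1 x else c2 x) ∈ S with hZ
      by_cases p : c1 x0 ∈ S <;> by_cases q : c2 y0 ∈ S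
      · have e : Z = X ∩ Y := by
          ext x; by_cases hx : x ∈ W <;> simp [hX, hY, hZ, hx, p, q]
        simp only [p, q, e]; simp
        linarith [hcap X Y]
      · have e : Z = (X ∩ W) ∪ Y := by
          ext x; by_cases hx : x ∈ W <;> simp [hX, hY, hZ, hx, p, q]
        simp only [p, q, e]; simp
        linarith [hcap X W, hcup (X ∩ W) Y]
      · have e : Z = X ∪ (Y ∩ Wᶜ) := by
          ext x; by_cases hx : x ∈ W <;> simp [hX, hY, hZ, hx, p, q]
        simp only [p, q, e]; simp
        linarith [hcap Y Wᶜ, hcup X (Y ∩ Wᶜ), hsym W]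
      · have e : Z = X ∪ Y := by
          ext x; by_cases hx : x ∈ W <;> simp [hX, hY, hZ, hx, p, q]
        simp only [p, q, e]; simp
        linarith [hcup X Y]
    · intro S
      have b1 := hu1 S
      have b2 := hu2 S
      have hcard : ((R.filter (· ∈ W)).card : ℝ) + ((R.filter (· ∈ Wᶜ)).card : ℝ) = R.card := by
        have := Finset.card_filter_add_card_filter_not (s := R) (fun x => x ∈ W)
        simp only [Finset.mem_compl]
        exact_mod_cast this
      have b3 : ((if c1 x0 ∈ S ∧ c2 y0 ∉ S then f W else 0)
          + (if c2 y0 ∈ S ∧ c1 x0 ∉ S then f W else 0)) ≤ f S := by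
        by_cases p : c1 x0 ∈ S <;> by_cases q : c2 y0 ∈ S
        · simpa [p, q] using hnn S
        · simpa [p, q] using hmin S ⟨⟨_, hr1.1, p⟩, ⟨_, hr2.1, q⟩⟩
        · simpa [p, q] using hmin S ⟨⟨_, hr2.1, q⟩, ⟨_, hr1.1, p⟩⟩
        · simpa [p, q] using hnn S
      rw [← hcard]
      linarith
  · obtain ⟨r, hr⟩ := hR
    have hone : ∀ x ∈ R, x = r := by
      intro x hx
      by_contra hne
      exact hsep ⟨{x}, ⟨x, hx, by simp⟩, ⟨r, hr, by simpa using fun h => hne h.symm⟩⟩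
    have hRs : R = {r} := Finset.eq_singleton_iff_unique_mem.2 ⟨hr, hone⟩
    refine ⟨fun _ => r, fun _ => 0, ⟨fun _ _ => 0, by simp, by simp, by simp⟩, fun _ => hr,
      fun x hx => (hone x hx).symm, fun _ _ _ => rfl, fun S => ?_, fun S => ?_⟩
    · by_cases h : r ∈ S <;> simp [h, h0, hU]
    · simp [hRs]


/-- Every non-negative symmetric submodular function `f` with `f(∅) = 0` on a ground
set of size `n ≥ 1` is `(n-1)`-approximated by an undirected cut function: there is a
symmetric non-negative weight function `w` such that for every `S`,
`f(S) ≤ ∑_{u ∈ S, v ∉ S} w u v ≤ (n-1)·f(S)`. -/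
theorem symmetric_submodular_approx_by_undirected_cut {α : Type*} [Fintype α] [DecidableEq α]
    (hn : 1 ≤ Fintype.card α)
    (f : Finset α → ℝ)
    (hnonneg : ∀ S : Finset α, 0 ≤ f S)
    (hsubmod : ∀ S T : Finset α, f (S ∪ T) + f (S ∩ T) ≤ f S + f T)
    (hsymm : ∀ S : Finset α, f S = f Sᶜ)
    (hempty : f ∅ = 0) :
    ∃ w : α → α → ℝ,
      (∀ u v : α, 0 ≤ w u v) ∧ (∀ u v : α, w u v = w v u) ∧
      ∀ S : Finset α,
        f S ≤ (∑ u ∈ S, ∑ v ∈ Sᶜ, w u v) ∧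
          (∑ u ∈ S, ∑ v ∈ Sᶜ, w u v) ≤ ((Fintype.card α : ℝ) - 1) * f S := by

  have hne : (Finset.univ : Finset α).Nonempty := Finset.card_pos.1 (by rw [Finset.card_univ]; omega)
  obtain ⟨c, K, ⟨w, hw0, hws, hwK⟩, -, hc, -, hlo, hup⟩ :=
    cut_tree_aux _ (Finset.univ : Finset α) rfl hne f hnonneg hsubmod hsymm hempty
  refine ⟨w, hw0, hws, fun S => ?_⟩
  rw [← hwK]
  refine ⟨?_, by simpa using hup S⟩
  have h := hlo S
  simpa [fun x => hc x (Finset.mem_univ x)] using h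
end

section
/- Let U be a finite set with |U| = n ≥ 2, and define f : 2^U → ℝ by f(S) = 1 if ∅ ≠ S ≠ U and f(S) = 0 otherwise. Suppose w : U × U → ℝ is a symmetric non-negative weight function and θ ∈ ℝ is such that for every S ⊆ U, f(S) ≤ Σ_{u ∈ S, v ∈ U \ S} w(u, v) ≤ θ·f(S). Then θ ≥ n/4. -/
/-- Lower bound for approximating symmetric submodular functions by undirected cut
functions.  Let `|U| = n ≥ 2` and let `f(S) = 1` for `∅ ≠ S ≠ U` and `f(S) = 0`
otherwise.  If a symmetric non-negative weight function `w` satisfies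
`f(S) ≤ ∑_{u ∈ S, v ∉ S} w u v ≤ θ·f(S)` for all `S`, then `θ ≥ n/4`. -/
theorem undirected_cut_lower_bound {α : Type*} [Fintype α] [DecidableEq α]
    (hn : 2 ≤ Fintype.card α)
    (f : Finset α → ℝ)
    (hf : ∀ S : Finset α, f S = if S ≠ ∅ ∧ S ≠ Finset.univ then 1 else 0)
    (w : α → α → ℝ) (hw : ∀ u v : α, 0 ≤ w u v) (hwsymm : ∀ u v : α, w u v = w v u)
    (θ : ℝ)
    (happrox : ∀ S : Finset α,
      f S ≤ (∑ u ∈ S, ∑ v ∈ Sᶜ, w u v) ∧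
        (∑ u ∈ S, ∑ v ∈ Sᶜ, w u v) ≤ θ * f S) :
    (Fintype.card α : ℝ) / 4 ≤ θ := by
  classical
  have hsing : ∀ u : α, 1 ≤ ∑ v ∈ ({u} : Finset α)ᶜ, w u v ∧
      ∑ v ∈ ({u} : Finset α)ᶜ, w u v ≤ θ := by
    intro u
    have h := happrox {u}
    have h1 : ({u} : Finset α) ≠ Finset.univ := by
      intro h
      have := congrArg Finset.card h
      rw [Finset.card_singleton, Finset.card_univ] at this
      omega
    rw [hf, if_pos ⟨Finset.singleton_ne_empty u, h1⟩] at h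
    simpa using h
  have hθ : 0 ≤ θ := by
    have : 0 < Fintype.card α := by omega
    obtain ⟨u⟩ := Fintype.card_pos_iff.1 this
    have := hsing u
    linarith
  have hup : ∀ S : Finset α, (∑ u ∈ S, ∑ v ∈ Sᶜ, w u v) ≤ θ := by
    intro S
    refine (happrox S).2.trans ?_
    rw [hf]
    split_ifs <;> simp [hθ]
  have hcount : ∀ u v : α, v ∈ ({u} : Finset α)ᶜ →
      ∑ S : Finset α, (if u ∈ S ∧ v ∈ Sᶜ then w u v else 0)
        = 2 ^ (Fintype.card α - 2) * w u v := by
    intro u v huv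
    have huv' : v ≠ u := by simpa using huv
    rw [← Finset.sum_filter, Finset.sum_const]
    have : (Finset.univ.filter fun S : Finset α => u ∈ S ∧ v ∈ Sᶜ)
        = Finset.Icc {u} ({v}ᶜ) := by
      ext S
      simp [Finset.subset_compl_comm (s := S)]
    rw [this, Finset.card_Icc_finset (by simpa using huv'), Finset.card_compl,
      Finset.card_singleton, Finset.card_singleton, nsmul_eq_mul, Nat.sub_sub]
    push_cast
    rfl
  have hsum : ∑ S : Finset α, (∑ u ∈ S, ∑ v ∈ Sᶜ, w u v)
      = ∑ u : α, ∑ v : α, ∑ S : Finset α, (if u ∈ S ∧ v ∈ Sᶜ then w u v else 0) := by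
    have : ∀ S : Finset α, (∑ u ∈ S, ∑ v ∈ Sᶜ, w u v)
        = ∑ u : α, ∑ v : α, (if u ∈ S ∧ v ∈ Sᶜ then w u v else 0) := by
      intro S
      simp only [ite_and]
      rw [← Finset.sum_subset (Finset.subset_univ S)]
      · refine Finset.sum_congr rfl fun u hu => ?_
        simp only [hu, if_true]
        rw [← Finset.sum_filter]
        congr 1
        ext v
        simp
      · intro u _ hu
        simp [hu]
    simp_rw [this]
    rw [Finset.sum_comm]
    exact Finset.sum_congr rfl fun u _ => Finset.sum_comm
  have hlow : (Fintype.card α : ℝ) * 2 ^ (Fintype.card α - 2)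
      ≤ ∑ S : Finset α, (∑ u ∈ S, ∑ v ∈ Sᶜ, w u v) := by
    rw [hsum]
    have : ∀ u ∈ (Finset.univ : Finset α), (2 : ℝ) ^ (Fintype.card α - 2) ≤
        ∑ v : α, ∑ S : Finset α, (if u ∈ S ∧ v ∈ Sᶜ then w u v else 0) := by
      intro u _
      calc (2 : ℝ) ^ (Fintype.card α - 2)
          ≤ 2 ^ (Fintype.card α - 2) * ∑ v ∈ ({u} : Finset α)ᶜ, w u v :=
            le_mul_of_one_le_right (by positivity) (hsing u).1
        _ = ∑ v ∈ ({u} : Finset α)ᶜ, ∑ S : Finset α,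
              (if u ∈ S ∧ v ∈ Sᶜ then w u v else 0) := by
            rw [Finset.mul_sum]
            exact Finset.sum_congr rfl fun v hv => (hcount u v hv).symm
        _ ≤ _ := by
            refine Finset.sum_le_sum_of_subset_of_nonneg (Finset.subset_univ _) ?_
            intro v _ _
            refine Finset.sum_nonneg fun S _ => ?_
            split_ifs
            · exact hw u v
            · exact le_rfl
    have h := Finset.card_nsmul_le_sum _ _ _ this
    simpa [nsmul_eq_mul] using h
  have hhigh : ∑ S : Finset α, (∑ u ∈ S, ∑ v ∈ Sᶜ, w u v)
      ≤ 2 ^ (Fintype.card α) * θ := by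
    have h := Finset.sum_le_card_nsmul (Finset.univ : Finset (Finset α)) _ θ
      (fun S _ => hup S)
    simpa [nsmul_eq_mul] using h
  have hpow : (2 : ℝ) ^ (Fintype.card α) = 2 ^ (Fintype.card α - 2) * 4 := by
    obtain ⟨k, hk⟩ := Nat.exists_eq_add_of_le' hn
    rw [hk, Nat.add_sub_cancel, pow_add]
    norm_num
  have hp : (0 : ℝ) < 2 ^ (Fintype.card α - 2) := by positivity
  rw [hpow] at hhigh
  have h3 : (2 : ℝ) ^ (Fintype.card α - 2) * (Fintype.card α : ℝ)
      ≤ 2 ^ (Fintype.card α - 2) * (4 * θ) := by linarith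
  have h4 := le_of_mul_le_mul_left h3 hp
  linarith
end

section
/- Let U be a finite set and let f : 2^U → ℝ be a budgeted additive function, i.e. f(S) = min(B, Σ_{i ∈ S} a_i) for some non-negative reals a_i (i ∈ U) and B ≥ 0. Then there exists a coverage function g : 2^U → ℝ — that is, a finite auxiliary set Z, a weight function ω : Z → ℝ≥0 and sets A_i ⊆ Z for i ∈ U with g(S) = Σ_{z ∈ ⋃_{i ∈ S} A_i} ω(z) — such that for every S ⊆ U, f(S) ≤ g(S) ≤ (e/(e−1))·f(S). -/
/-- `g` is a coverage function: there are a finite auxiliary ground set `Z` (taken to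
be `Fin N`), non-negative weights `ω : Z → ℝ`, and sets `A i ⊆ Z` for `i ∈ U`, such
that `g S = ∑_{z ∈ ⋃_{i ∈ S} A i} ω z` for all `S`. -/
def IsCoverage {α : Type*} [DecidableEq α] (g : Finset α → ℝ) : Prop :=
  ∃ (N : ℕ) (ω : Fin N → ℝ) (A : α → Finset (Fin N)),
    (∀ z, 0 ≤ ω z) ∧ ∀ S : Finset α, g S = ∑ z ∈ S.biUnion A, ω z

theorem isCoverage_of_fintype {α : Type*} [DecidableEq α] {Z : Type*} [Fintype Z] [DecidableEq Z]
    (ω : Z → ℝ) (A : α → Finset Z) (h : ∀ z, 0 ≤ ω z) :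
    IsCoverage (fun S : Finset α => ∑ z ∈ S.biUnion A, ω z) := by
  classical
  let e := Fintype.equivFin Z
  refine ⟨Fintype.card Z, fun k => ω (e.symm k), fun i => (A i).map e.toEmbedding,
    fun z => h _, fun S => ?_⟩
  have : (S.biUnion fun i => (A i).map e.toEmbedding) = (S.biUnion A).map e.toEmbedding := by
    ext z
    simp only [Finset.mem_biUnion, Finset.mem_map]
    constructor
    · rintro ⟨i, hi, w, hw, rfl⟩
      exact ⟨w, ⟨i, hi, hw⟩, rfl⟩
    · rintro ⟨w, ⟨i, hi, hw⟩, rfl⟩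
      exact ⟨i, hi, w, hw, rfl⟩
  simp only [this, Finset.sum_map]
  simp

theorem coverage_prob {α : Type*} [Fintype α] [DecidableEq α] (x : α → ℝ) (S : Finset α) :
    ∑ T ∈ S.biUnion (fun i => (Finset.univ : Finset (Finset α)).filter (fun T => i ∈ T)),
      ((∏ i ∈ T, x i) * ∏ i ∈ Finset.univ \ T, (1 - x i)) = 1 - ∏ i ∈ S, (1 - x i) := by
  have h1 : ∑ T : Finset α, ((∏ i ∈ T, x i) * ∏ i ∈ Finset.univ \ T, (1 - x i)) = 1 := by
    have := Finset.prod_add x (fun i => 1 - x i) Finset.univ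
    simp only [Finset.powerset_univ] at this
    rw [← this]; simp
  have h2 : ∑ T : Finset α, (if Disjoint T S then
      ((∏ i ∈ T, x i) * ∏ i ∈ Finset.univ \ T, (1 - x i)) else 0) = ∏ i ∈ S, (1 - x i) := by
    have := Finset.prod_add (fun i => if i ∈ S then 0 else x i) (fun i => 1 - x i) Finset.univ
    simp only [Finset.powerset_univ] at this
    have h3 : ∏ i ∈ S, (1 - x i) = ∏ i : α, ((if i ∈ S then 0 else x i) + (1 - x i)) := by
      rw [← Finset.prod_subset (Finset.subset_univ S)]
      · exact Finset.prod_congr rfl fun i hi => by simp [hi]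
      · intro i _ hi; simp [hi]
    rw [h3, this]
    refine Finset.sum_congr rfl fun T _ => ?_
    split_ifs with hd
    · congr 1
      exact Finset.prod_congr rfl fun i hi => by simp [Finset.disjoint_left.1 hd hi]
    · obtain ⟨i, hi, hs⟩ := Finset.not_disjoint_iff.1 hd
      rw [Finset.prod_eq_zero hi (by simp [hs]), zero_mul]
  have h4 : S.biUnion (fun i => (Finset.univ : Finset (Finset α)).filter (fun T => i ∈ T))
      = Finset.univ.filter (fun T => ¬ Disjoint T S) := by
    ext T
    simp [Finset.not_disjoint_iff, and_comm]
  rw [h4, ← h2, ← Finset.sum_filter, eq_sub_iff_add_eq, add_comm,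
    Finset.sum_filter_add_sum_filter_not, h1]

theorem one_sub_prod_le {α : Type*} [DecidableEq α] (x : α → ℝ) (h0 : ∀ i, 0 ≤ x i)
    (h1 : ∀ i, x i ≤ 1) (S : Finset α) : 1 - ∏ i ∈ S, (1 - x i) ≤ ∑ i ∈ S, x i := by
  induction S using Finset.induction_on with
  | empty => simp
  | insert i S hi ih =>
    rw [Finset.prod_insert hi, Finset.sum_insert hi]
    have : ∏ i ∈ S, (1 - x i) ≤ 1 :=
      Finset.prod_le_one (fun i _ => by linarith [h1 i]) (fun i _ => by linarith [h0 i])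
    nlinarith [h0 i]

theorem exp_chord (m : ℝ) (h0 : 0 ≤ m) (h1 : m ≤ 1) :
    Real.exp (-m) ≤ 1 - m * (1 - Real.exp (-1)) := by
  have := convexOn_exp.2 (Set.mem_univ (0:ℝ)) (Set.mem_univ (-1:ℝ)) (sub_nonneg.2 h1) h0 (by ring)
  simp only [smul_eq_mul, mul_zero, zero_add, Real.exp_zero, mul_neg, mul_one] at this
  linarith

theorem lower_bound {α : Type*} (x : α → ℝ) (h0 : ∀ i, 0 ≤ x i)
    (h1 : ∀ i, x i ≤ 1) (S : Finset α) :
    (1 - Real.exp (-1)) * min 1 (∑ i ∈ S, x i) ≤ 1 - ∏ i ∈ S, (1 - x i) := by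
  have hp : ∏ i ∈ S, (1 - x i) ≤ Real.exp (-∑ i ∈ S, x i) := by
    rw [← Finset.sum_neg_distrib, Real.exp_sum]
    exact Finset.prod_le_prod (fun i _ => by linarith [h1 i])
      (fun i _ => by linarith [Real.add_one_le_exp (-x i)])
  have hs : 0 ≤ ∑ i ∈ S, x i := Finset.sum_nonneg fun i _ => h0 i
  have hm : Real.exp (-∑ i ∈ S, x i) ≤ Real.exp (-min 1 (∑ i ∈ S, x i)) :=
    Real.exp_le_exp.2 (neg_le_neg (min_le_right _ _))
  have := exp_chord (min 1 (∑ i ∈ S, x i)) (le_min zero_le_one hs) (min_le_left _ _)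
  linarith

theorem trunc_min {α : Type*} (a : α → ℝ) (ha : ∀ i, 0 ≤ a i) (B : ℝ) (hB : 0 < B)
    (S : Finset α) :
    min B (∑ i ∈ S, a i) = B * min 1 (∑ i ∈ S, min 1 (a i / B)) := by
  have hx : ∀ i, 0 ≤ min 1 (a i / B) := fun i => le_min zero_le_one (div_nonneg (ha i) hB.le)
  by_cases h : ∃ i ∈ S, B ≤ a i
  · obtain ⟨i, hi, hb⟩ := h
    have e1 : B ≤ ∑ i ∈ S, a i := hb.trans (Finset.single_le_sum (fun j _ => ha j) hi)
    have e2 : 1 ≤ ∑ i ∈ S, min 1 (a i / B) :=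
      (le_min le_rfl ((one_le_div hB).2 hb)).trans
        (Finset.single_le_sum (f := fun i => min 1 (a i / B)) (fun j _ => hx j) hi)
    rw [min_eq_left e1, min_eq_left e2, mul_one]
  · push Not at h
    have : ∑ i ∈ S, min 1 (a i / B) = (∑ i ∈ S, a i) / B := by
      rw [Finset.sum_div]
      exact Finset.sum_congr rfl fun i hi => min_eq_right ((div_le_one hB).2 (h i hi).le)
    rw [this, mul_min_of_nonneg _ _ hB.le, mul_one, mul_div_cancel₀ _ hB.ne']

/-- Every budgeted additive function `f(S) = min(B, ∑_{i ∈ S} a i)` is approximated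
within a factor `e/(e-1)` by a coverage function `g`: `f(S) ≤ g(S) ≤ (e/(e-1))·f(S)`
for all `S`. -/
theorem budgeted_additive_approx_by_coverage {α : Type*} [Fintype α] [DecidableEq α]
    (a : α → ℝ) (ha : ∀ i, 0 ≤ a i) (B : ℝ) (hB : 0 ≤ B)
    (f : Finset α → ℝ) (hf : ∀ S : Finset α, f S = min B (∑ i ∈ S, a i)) :
    ∃ g : Finset α → ℝ, IsCoverage g ∧
      ∀ S : Finset α,
        f S ≤ g S ∧ g S ≤ (Real.exp 1 / (Real.exp 1 - 1)) * f S := by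
  have he : 1 < Real.exp 1 := by simp
  have hc : Real.exp 1 / (Real.exp 1 - 1) * (1 - Real.exp (-1)) = 1 := by
    have : Real.exp 1 - 1 ≠ 0 := by linarith
    rw [Real.exp_neg]
    field_simp
  have hc0 : 0 ≤ Real.exp 1 / (Real.exp 1 - 1) := div_nonneg (by linarith) (by linarith)
  generalize Real.exp 1 / (Real.exp 1 - 1) = c at hc hc0 ⊢
  rcases hB.eq_or_lt with rfl | hB
  · refine ⟨fun _ => 0, ⟨0, fun _ => 0, fun _ => ∅, by simp, by simp⟩, fun S => ?_⟩
    have : f S = 0 := by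
      rw [hf, min_eq_left (Finset.sum_nonneg fun i _ => ha i)]
    simp [this]
  · have h0 : ∀ i, 0 ≤ min 1 (a i / B) := fun i => le_min zero_le_one (div_nonneg (ha i) hB.le)
    have h1 : ∀ i, min 1 (a i / B) ≤ 1 := fun i => min_le_left _ _
    have hfS : ∀ S, f S = B * min 1 (∑ i ∈ S, min 1 (a i / B)) := fun S => by
      rw [hf, trunc_min a ha B hB]
    generalize hx : (fun i => min 1 (a i / B)) = x at *
    replace hx : ∀ i, min 1 (a i / B) = x i := fun i => congrFun hx i
    simp only [hx] at h0 h1 hfS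
    refine ⟨_, isCoverage_of_fintype (Z := Finset α)
      (fun T => c * B * ((∏ i ∈ T, x i) * ∏ i ∈ Finset.univ \ T, (1 - x i)))
      (fun i => (Finset.univ : Finset (Finset α)).filter (fun T => i ∈ T)) ?_, fun S => ?_⟩
    · intro T
      exact mul_nonneg (mul_nonneg hc0 hB.le) (mul_nonneg (Finset.prod_nonneg fun i _ => h0 i)
        (Finset.prod_nonneg fun i _ => sub_nonneg.2 (h1 i)))
    · simp only [← Finset.mul_sum]
      rw [coverage_prob, hfS]
      constructor
      · calc B * min 1 (∑ i ∈ S, x i)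
            = c * B * ((1 - Real.exp (-1)) * min 1 (∑ i ∈ S, x i)) := by
              linear_combination (-(B * min 1 (∑ i ∈ S, x i))) * hc
          _ ≤ _ := mul_le_mul_of_nonneg_left (lower_bound x h0 h1 S) (mul_nonneg hc0 hB.le)
      · rw [← mul_assoc]
        refine mul_le_mul_of_nonneg_left (le_min ?_ (one_sub_prod_le x h0 h1 S))
          (mul_nonneg hc0 hB.le)
        have : 0 ≤ ∏ i ∈ S, (1 - x i) := Finset.prod_nonneg fun i _ => sub_nonneg.2 (h1 i)
        linarith
end

section
/- Let k ≥ 1 be an integer, let U be a finite set with |U| = n = k², and let f_k(S) = min(|S|, k) for S ⊆ U. Suppose x : 2^U → ℝ≥0 and β ∈ ℝ satisfy, for every S ⊆ U, Σ_{T ⊆ U : T ∩ S ≠ ∅} x_T ≤ f_k(S) and β·f_k(S) ≤ Σ_{T ⊆ U : T ∩ S ≠ ∅} x_T. Then β ≤ 1 − C(k² − k, k)/C(k², k), where C(·,·) denotes the binomial coefficient. -/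
lemma choose_tangent (j a m : ℕ) :
    (a.choose (j+1) : ℝ) + (a.choose j : ℝ) * ((m : ℝ) - a) ≤ (m.choose (j+1) : ℝ) := by
  rcases le_total a m with h | h
  · induction m, h using Nat.le_induction with
    | base => simp
    | succ m hm ih =>
      have h1 : (a.choose j : ℝ) ≤ m.choose j := by exact_mod_cast Nat.choose_le_choose j hm
      rw [Nat.choose_succ_succ]
      push_cast
      linarith
  · induction a, h using Nat.le_induction with
    | base => simp
    | succ a ha ih =>
      have h1 : (a.choose j : ℝ) ≤ (a+1).choose j := by
        exact_mod_cast Nat.choose_le_choose j (Nat.le_succ a)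
      have h2 : (m : ℝ) ≤ a := by exact_mod_cast ha
      rw [Nat.choose_succ_succ a j]
      push_cast
      nlinarith

lemma card_meet {α : Type*} [Fintype α] [DecidableEq α] (k : ℕ) (T : Finset α) :
    ((((Finset.univ : Finset α).powersetCard k).filter
      (fun S => (T ∩ S).Nonempty)).card : ℝ) =
    (Fintype.card α).choose k - (Fintype.card α - T.card).choose k := by
  have h := Finset.card_filter_add_card_filter_not (s := (Finset.univ : Finset α).powersetCard k)
    (fun S => (T ∩ S).Nonempty)
  have h2 : ((Finset.univ : Finset α).powersetCard k).filter
      (fun S => ¬ (T ∩ S).Nonempty) = (Tᶜ).powersetCard k := by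
    ext S
    simp only [Finset.mem_filter, Finset.mem_powersetCard, Finset.subset_univ, true_and,
      Finset.not_nonempty_iff_eq_empty, ← Finset.disjoint_iff_inter_eq_empty]
    rw [Finset.subset_compl_comm, Finset.subset_compl_iff_disjoint_right, and_comm]
  rw [h2, Finset.card_powersetCard, Finset.card_powersetCard, Finset.card_compl,
    Finset.card_univ] at h
  rw [← h]
  push_cast
  ring

/-- Dual lower bound for approximating the budgeted additive function
`f_k(S) = min(|S|, k)` on a ground set of size `n = k²` by coverage functions.
If non-negative reals `x_T` satisfy `∑_{T ∩ S ≠ ∅} x_T ≤ f_k(S)` and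
`β·f_k(S) ≤ ∑_{T ∩ S ≠ ∅} x_T` for every `S`, then
`β ≤ 1 - C(k² - k, k)/C(k², k)`. -/
theorem coverage_dual_bound {α : Type*} [Fintype α] [DecidableEq α]
    (k : ℕ) (hk : 1 ≤ k) (hcard : Fintype.card α = k ^ 2)
    (x : Finset α → ℝ) (hx : ∀ T : Finset α, 0 ≤ x T) (β : ℝ)
    (hupper : ∀ S : Finset α,
      (∑ T ∈ Finset.univ.filter (fun T : Finset α => (T ∩ S).Nonempty), x T) ≤
        min (S.card : ℝ) (k : ℝ))
    (hlower : ∀ S : Finset α,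
      β * min (S.card : ℝ) (k : ℝ) ≤
        ∑ T ∈ Finset.univ.filter (fun T : Finset α => (T ∩ S).Nonempty), x T) :
    β ≤ 1 - ((k ^ 2 - k).choose k : ℝ) / ((k ^ 2).choose k : ℝ) := by
  obtain ⟨j, rfl⟩ : ∃ j, k = j + 1 := ⟨k - 1, by omega⟩
  set k := j + 1 with hkj
  have hkn : k ≤ k ^ 2 := by nlinarith
  have hkpos : (0 : ℝ) < k := by exact_mod_cast hk
  set N : ℝ := ((k ^ 2).choose k : ℝ) with hN
  have hNpos : 0 < N := by
    rw [hN]; exact_mod_cast Nat.choose_pos hkn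
  set A : ℝ := ((k ^ 2 - k).choose k : ℝ) with hA
  set D : ℝ := ((k ^ 2 - k).choose j : ℝ) with hD
  have hD0 : 0 ≤ D := by positivity
  set c : Finset α → ℝ := fun T => ((((Finset.univ : Finset α).powersetCard k).filter
      (fun S => (T ∩ S).Nonempty)).card : ℝ) with hc
  have hcT : ∀ T, c T ≤ (N - A - D * k) + D * T.card := by
    intro T
    have h1 := card_meet k T
    have h2 := choose_tangent j (k ^ 2 - k) (k ^ 2 - T.card)
    have h3 : T.card ≤ k ^ 2 := hcard ▸ Finset.card_le_univ T
    rw [Nat.cast_sub hkn, Nat.cast_sub h3] at h2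
    rw [hcard] at h1
    simp only [hc]
    rw [h1]
    linarith
  have hc0 : c ∅ = 0 := by simp [hc]
  have hE : 0 ≤ N - A - D * k := by
    have := hcT ∅
    rw [hc0] at this
    simpa using this
  -- total weight
  have htot : ∑ T ∈ Finset.univ.filter (fun T : Finset α => T.Nonempty), x T ≤ k := by
    have := (hupper Finset.univ).trans (min_le_right _ _)
    simpa using this
  have hsize : ∑ T : Finset α, (T.card : ℝ) * x T ≤ (k : ℝ) ^ 2 := by
    have h1 : ∀ u : α, ∑ T : Finset α, (if u ∈ T then x T else 0) ≤ 1 := by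
      intro u
      have := (hupper {u}).trans (min_le_left _ _)
      rw [Finset.sum_filter] at this
      refine le_trans (le_of_eq ?_) (this.trans (by simp))
      refine Finset.sum_congr rfl fun T _ => ?_
      by_cases hu : u ∈ T <;> simp [hu]
    have h2 := Finset.sum_le_sum (s := (Finset.univ : Finset α)) fun u _ => h1 u
    rw [Finset.sum_comm] at h2
    simp only [Finset.sum_ite_mem, Finset.univ_inter, Finset.sum_const, nsmul_eq_mul,
      Finset.card_univ, hcard, mul_one] at h2
    exact_mod_cast h2
  have hlow : N * (β * k) ≤ ∑ T : Finset α, c T * x T := by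
    have h1 : ∀ S ∈ (Finset.univ : Finset α).powersetCard k, β * k ≤
        ∑ T : Finset α, if (T ∩ S).Nonempty then x T else 0 := by
      intro S hS
      have := hlower S
      rw [(Finset.mem_powersetCard.1 hS).2, min_self, Finset.sum_filter] at this
      exact this
    have h2 := Finset.sum_le_sum h1
    rw [Finset.sum_comm] at h2
    simp only [← Finset.sum_filter, Finset.sum_const, nsmul_eq_mul, Finset.card_powersetCard,
      Finset.card_univ, hcard] at h2
    exact h2
  have hup : ∑ T : Finset α, c T * x T ≤
      (N - A - D * k) * (∑ T ∈ Finset.univ.filter (fun T : Finset α => T.Nonempty), x T)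
        + D * ∑ T : Finset α, (T.card : ℝ) * x T := by
    rw [Finset.sum_filter, Finset.mul_sum, Finset.mul_sum, ← Finset.sum_add_distrib]
    refine Finset.sum_le_sum fun T _ => ?_
    rcases T.eq_empty_or_nonempty with rfl | hT
    · simp [hc0]
    · have := mul_le_mul_of_nonneg_right (hcT T) (hx T)
      simp only [hT, if_true]
      linarith
  have hfin : N * (β * k) ≤ (N - A) * k := by
    have h1 := mul_le_mul_of_nonneg_left htot hE
    have h2 := mul_le_mul_of_nonneg_left hsize hD0
    nlinarith
  have hfin2 : β * N ≤ N - A := by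
    refine le_of_mul_le_mul_right ?_ hkpos
    linarith
  have : 1 - A / N = (N - A) / N := by field_simp
  rw [this, le_div_iff₀ hNpos]
  exact hfin2
end

section
/- For every ε > 0 there exist a finite set U and a budgeted additive function f : 2^U → ℝ (namely f(S) = min(|S|, k) on a ground set of size k² for a sufficiently large integer k) such that no coverage function approximates f within a factor of e/(e−1) − ε; that is, there is no coverage function g with f(S) ≤ g(S) ≤ (e/(e−1) − ε)·f(S) for all S ⊆ U. -/
lemma count_hit (n k : ℕ) (B : Finset (Fin n)) :
    ∑ φ : Fin k → Fin n, (if ∃ j, φ j ∈ B then (1 : ℝ) else 0)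
      = (n : ℝ) ^ k - ((n : ℝ) - B.card) ^ k := by
  have h1 : ∑ φ : Fin k → Fin n, (if ∀ j, φ j ∉ B then (1 : ℝ) else 0)
      = ((n : ℝ) - B.card) ^ k := by
    rw [Finset.sum_boole]
    have : (Finset.univ.filter fun φ : Fin k → Fin n => ∀ j, φ j ∉ B)
        = Fintype.piFinset fun _ => Bᶜ := by
      ext φ; simp [Fintype.mem_piFinset]
    rw [this, Fintype.card_piFinset]
    have hB : B.card ≤ n := by simpa using Finset.card_le_univ B
    simp [Finset.card_compl, Nat.cast_sub hB]
  rw [← h1, eq_sub_iff_add_eq, ← Finset.sum_add_distrib]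
  rw [Finset.sum_congr rfl (g := fun _ => (1 : ℝ))]
  · simp
  · intro φ _
    by_cases h : ∃ j, φ j ∈ B
    · have h' : ¬ ∀ j, φ j ∉ B := by push Not; exact h
      rw [if_pos h, if_neg h']; simp
    · have h' : ∀ j, φ j ∉ B := by push Not at h; exact h
      rw [if_neg h, if_pos h']; simp

lemma sum_coverage (n k N : ℕ) (T : Finset (Fin N)) (ω : Fin N → ℝ) (A : Fin n → Finset (Fin N))
    (hT : ∀ i, A i ⊆ T) :
    ∑ φ : Fin k → Fin n, ∑ z ∈ (Finset.univ.image φ).biUnion A, ω z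
      = ∑ z ∈ T, ω z * ((n : ℝ) ^ k
          - ((n : ℝ) - (Finset.univ.filter fun i => z ∈ A i).card) ^ k) := by
  have h : ∀ φ : Fin k → Fin n, ∑ z ∈ (Finset.univ.image φ).biUnion A, ω z
      = ∑ z ∈ T, ω z * (if ∃ j, φ j ∈ (Finset.univ.filter fun i => z ∈ A i)
          then (1 : ℝ) else 0) := by
    intro φ
    simp only [mul_ite, mul_one, mul_zero]
    rw [← Finset.sum_filter]
    apply Finset.sum_congr _ (fun _ _ => rfl)
    ext z
    simp only [Finset.mem_biUnion, Finset.mem_image, Finset.mem_univ, true_and,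
      Finset.mem_filter]
    constructor
    · rintro ⟨_, ⟨j, rfl⟩, hz⟩
      exact ⟨hT _ hz, j, hz⟩
    · rintro ⟨_, j, hz⟩
      exact ⟨_, ⟨j, rfl⟩, hz⟩
  simp_rw [h]
  rw [Finset.sum_comm]
  apply Finset.sum_congr rfl
  intro z _
  rw [← Finset.mul_sum, count_hit]

lemma sum_card_image (n k : ℕ) :
    ∑ φ : Fin k → Fin n, ((Finset.univ.image φ).card : ℝ)
      = n * ((n : ℝ) ^ k - ((n : ℝ) - 1) ^ k) := by
  have h := sum_coverage n k n Finset.univ (fun _ => 1) (fun i => {i})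
    (fun i => Finset.subset_univ _)
  have e : ∀ z : Fin n, (Finset.univ.filter fun i => z = i) = {z} := by
    intro z; ext i; simp [eq_comm]
  simpa [Finset.biUnion_singleton_eq_self, e, mul_sub] using h

lemma tangent (k : ℕ) (hk : 2 ≤ k) (x : ℝ) (hx : x ≤ 1) :
    (1 - 1 / (k : ℝ)) ^ k * (1 + (1 - k * x) * (k / (k - 1))) ≤ (1 - x) ^ k := by
  have hk' : (2 : ℝ) ≤ k := by exact_mod_cast hk
  have hk1 : (0 : ℝ) < k - 1 := by linarith
  have hk0 : (0 : ℝ) < k := by linarith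
  have e1 : 1 + (1 / (k : ℝ) - x) * (k / (k - 1)) = (1 - x) * (k / (k - 1)) := by
    field_simp; ring
  have hnn : 0 ≤ (1 - x) * ((k : ℝ) / (k - 1)) := mul_nonneg (by linarith) (by positivity)
  have hb := one_add_mul_le_pow (a := (1 / (k : ℝ) - x) * (k / (k - 1))) (by linarith) k
  have e2 : (k : ℝ) * ((1 / (k : ℝ) - x) * (k / (k - 1))) = (1 - k * x) * (k / (k - 1)) := by
    field_simp
  rw [e1, e2] at hb
  have hq : 0 ≤ 1 - 1 / (k : ℝ) := by
    rw [sub_nonneg, div_le_one hk0]; linarith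
  calc _ ≤ (1 - 1 / (k : ℝ)) ^ k * ((1 - x) * ((k : ℝ) / (k - 1))) ^ k :=
        mul_le_mul_of_nonneg_left hb (pow_nonneg hq _)
    _ = (1 - x) ^ k := by
        rw [← mul_pow]; congr 1; field_simp

lemma key (k n : ℕ) (hn : n = k ^ 2) (hk : 2 ≤ k) (c : ℝ) (g : Finset (Fin n) → ℝ) (hg : IsCoverage g)
    (h : ∀ S : Finset (Fin n), min (S.card : ℝ) (k : ℝ) ≤ g S ∧
      g S ≤ c * min (S.card : ℝ) (k : ℝ)) :
    (k : ℝ) / (k + 1) ≤ c * (1 - (1 - 1 / (k : ℝ)) ^ k) := by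
  obtain ⟨N, ω, A, hω, hgA⟩ := hg
  have hk' : (2 : ℝ) ≤ k := by exact_mod_cast hk
  have hk1 : (0 : ℝ) < k - 1 := by linarith
  have hk0 : (0 : ℝ) < k := by linarith
  have hnR : (n : ℝ) = (k : ℝ) ^ 2 := by rw [hn]; push_cast; rfl
  have hn0 : (0 : ℝ) < n := by rw [hnR]; positivity
  set T := (Finset.univ : Finset (Fin n)).biUnion A with hTdef
  have hT : ∀ i, A i ⊆ T := fun i => Finset.subset_biUnion_of_mem A (Finset.mem_univ i)
  set x : Fin N → ℝ := fun z => ((Finset.univ.filter fun i => z ∈ A i).card : ℝ) / n with hx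
  have hx1 : ∀ z, x z ≤ 1 := by
    intro z
    rw [hx]; simp only
    rw [div_le_one hn0]
    exact_mod_cast (by simpa using Finset.card_le_univ (Finset.univ.filter fun i => z ∈ A i))
  -- total weight
  have hW : ∑ z ∈ T, ω z ≤ c * k := by
    have := (h Finset.univ).2
    rw [hgA] at this
    have e : min (((Finset.univ : Finset (Fin n)).card : ℝ)) (k : ℝ) = k := by
      rw [Finset.card_univ, Fintype.card_fin, hnR]
      apply min_eq_right; nlinarith
    rwa [e] at this
  -- singletons
  have hX : ∑ z ∈ T, ω z * x z ≤ c := by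
    have hs : ∀ i : Fin n, ∑ z ∈ A i, ω z ≤ c := by
      intro i
      have := (h {i}).2
      rw [hgA] at this
      have e : min ((({i} : Finset (Fin n)).card : ℝ)) (k : ℝ) = 1 := by
        rw [Finset.card_singleton]; simp; linarith
      rw [e] at this
      simpa using this
    have hsum : ∑ i : Fin n, ∑ z ∈ A i, ω z = n * ∑ z ∈ T, ω z * x z := by
      have : ∀ i : Fin n, ∑ z ∈ A i, ω z = ∑ z ∈ T, if z ∈ A i then ω z else 0 := by
        intro i
        rw [← Finset.sum_filter]
        apply Finset.sum_congr _ (fun _ _ => rfl)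
        ext z
        simp only [Finset.mem_filter]
        exact ⟨fun hz => ⟨hT i hz, hz⟩, fun hz => hz.2⟩
      simp_rw [this]
      rw [Finset.sum_comm, Finset.mul_sum]
      apply Finset.sum_congr rfl
      intro z _
      rw [← Finset.sum_filter, Finset.sum_const, nsmul_eq_mul, hx]
      field_simp
    have hle : ∑ i : Fin n, ∑ z ∈ A i, ω z ≤ n * c := by
      calc _ ≤ ∑ i : Fin n, c := Finset.sum_le_sum fun i _ => hs i
        _ = n * c := by simp
    rw [hsum] at hle
    exact le_of_mul_le_mul_left hle hn0
  -- averaging over k-tuples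
  have havg : n * (1 - (1 - 1 / (n : ℝ)) ^ k) ≤ ∑ z ∈ T, ω z * (1 - (1 - x z) ^ k) := by
    have h1 : ∑ φ : Fin k → Fin n, ((Finset.univ.image φ).card : ℝ)
        ≤ ∑ φ : Fin k → Fin n, ∑ z ∈ (Finset.univ.image φ).biUnion A, ω z := by
      apply Finset.sum_le_sum
      intro φ _
      have := (h (Finset.univ.image φ)).1
      rw [hgA, min_eq_left] at this
      · exact this
      · have hc := Finset.card_image_le (s := Finset.univ) (f := φ)
        simp only [Finset.card_univ, Fintype.card_fin] at hc
        exact_mod_cast hc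
    rw [sum_card_image, sum_coverage n k N T ω A hT] at h1
    have hnk : (0 : ℝ) < (n : ℝ) ^ k := by positivity
    refine le_of_mul_le_mul_left ?_ hnk
    have e1 : (n : ℝ) ^ k * (n * (1 - (1 - 1 / (n : ℝ)) ^ k))
        = n * ((n : ℝ) ^ k - ((n : ℝ) - 1) ^ k) := by
      have : ((n : ℝ) - 1) ^ k = (n : ℝ) ^ k * (1 - 1 / (n : ℝ)) ^ k := by
        rw [← mul_pow]; congr 1; field_simp
      rw [this]; ring
    have e2 : (n : ℝ) ^ k * ∑ z ∈ T, ω z * (1 - (1 - x z) ^ k)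
        = ∑ z ∈ T, ω z * ((n : ℝ) ^ k
          - ((n : ℝ) - (Finset.univ.filter fun i => z ∈ A i).card) ^ k) := by
      rw [Finset.mul_sum]
      apply Finset.sum_congr rfl
      intro z _
      have : ((n : ℝ) - (Finset.univ.filter fun i => z ∈ A i).card) ^ k
          = (n : ℝ) ^ k * (1 - x z) ^ k := by
        rw [← mul_pow]; congr 1; rw [hx]; field_simp
      rw [this]; ring
    rw [e1, e2]; exact h1
  -- lower bound for the left side
  have hlow : (k : ℝ) * (k / (k + 1)) ≤ n * (1 - (1 - 1 / (n : ℝ)) ^ k) := by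
    have hb := one_add_mul_le_pow (a := 1 / (n : ℝ)) (by
      have : 0 < 1 / (n : ℝ) := by positivity
      linarith) k
    have hle1 : 1 / (n : ℝ) ≤ 1 := by
      rw [div_le_one hn0, hnR]; nlinarith
    have hp0 : 0 ≤ (1 - 1 / (n : ℝ)) ^ k := pow_nonneg (by linarith) _
    have hprod : (1 - 1 / (n : ℝ)) ^ k * (1 + 1 / (n : ℝ)) ^ k ≤ 1 := by
      rw [← mul_pow]
      apply pow_le_one₀
      · apply mul_nonneg (by linarith); positivity
      · nlinarith [sq_nonneg (1 / (n : ℝ))]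
    have hm : (1 - 1 / (n : ℝ)) ^ k * (1 + k * (1 / (n : ℝ))) ≤ 1 :=
      (mul_le_mul_of_nonneg_left hb hp0).trans hprod
    generalize (1 - 1 / (n : ℝ)) ^ k = p at *
    rw [hnR] at hm ⊢
    have e : 1 + (k : ℝ) * (1 / (k : ℝ) ^ 2) = (k + 1) / k := by field_simp
    rw [e] at hm
    have hm2 : p ≤ k / (k + 1) := by
      rw [mul_div_assoc', div_le_one hk0] at hm
      rw [le_div_iff₀ (by linarith)]; exact hm
    have : (k : ℝ) * (k / (k + 1)) = k ^ 2 * (1 - k / (k + 1)) := by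
      field_simp; ring
    rw [this]
    apply mul_le_mul_of_nonneg_left _ (by positivity)
    linarith
  -- upper bound for the right side
  have hup : ∑ z ∈ T, ω z * (1 - (1 - x z) ^ k) ≤ c * k * (1 - (1 - 1 / (k : ℝ)) ^ k) := by
    set q := (1 - 1 / (k : ℝ)) ^ k with hq
    have hq0 : 0 ≤ q := by
      apply pow_nonneg
      rw [sub_nonneg, div_le_one hk0]; linarith
    set d := (k : ℝ) / (k - 1) with hd
    have hd0 : 0 ≤ d := by rw [hd]; positivity
    have h0 := tangent k hk 0 (by norm_num)
    rw [← hq, ← hd] at h0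
    have h0' : q * (1 + d) ≤ 1 := by simpa using h0
    have hs : ∑ z ∈ T, ω z * (1 - (1 - x z) ^ k)
        ≤ ∑ z ∈ T, ((1 - q * (1 + d)) * ω z + q * d * k * (ω z * x z)) := by
      apply Finset.sum_le_sum
      intro z _
      have ht := tangent k hk (x z) (hx1 z)
      rw [← hq, ← hd] at ht
      have := mul_le_mul_of_nonneg_left ht (hω z)
      nlinarith
    rw [Finset.sum_add_distrib, ← Finset.mul_sum, ← Finset.mul_sum] at hs
    have a1 := mul_le_mul_of_nonneg_left hW (sub_nonneg.2 h0')
    have a2 := mul_le_mul_of_nonneg_left hX (mul_nonneg (mul_nonneg hq0 hd0) hk0.le)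
    calc _ ≤ _ := hs
      _ ≤ (1 - q * (1 + d)) * (c * k) + q * d * k * c := add_le_add a1 a2
      _ = _ := by ring
  have := (hlow.trans havg).trans hup
  refine le_of_mul_le_mul_left ?_ hk0
  linarith

lemma exists_k (c : ℝ) (hc : c < Real.exp 1 / (Real.exp 1 - 1)) :
    ∃ k : ℕ, 2 ≤ k ∧ c * (1 - (1 - 1 / (k : ℝ)) ^ k) < (k : ℝ) / (k + 1) := by
  have l1 : Filter.Tendsto (fun k : ℕ => (1 - 1 / (k : ℝ)) ^ k) Filter.atTop
      (nhds (Real.exp (-1))) := by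
    have := Real.tendsto_one_add_div_pow_exp (-1)
    refine this.congr fun k => ?_
    congr 1; ring
  have l2 : Filter.Tendsto (fun k : ℕ => c * (1 - (1 - 1 / (k : ℝ)) ^ k)) Filter.atTop
      (nhds (c * (1 - Real.exp (-1)))) := (l1.const_sub 1).const_mul c
  have l3 : Filter.Tendsto (fun k : ℕ => (k : ℝ) / (k + 1)) Filter.atTop (nhds 1) :=
    tendsto_natCast_div_add_atTop 1
  have he : 1 < Real.exp 1 := by simp
  have hlt : c * (1 - Real.exp (-1)) < 1 := by
    rw [lt_div_iff₀ (by linarith)] at hc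
    rw [Real.exp_neg]
    have : c * (1 - (Real.exp 1)⁻¹) = c * (Real.exp 1 - 1) / Real.exp 1 := by
      field_simp
    rw [this, div_lt_one (by linarith)]
    exact hc
  have hev := (l2.eventually_lt l3 hlt).and (Filter.eventually_ge_atTop 2)
  obtain ⟨k, hk1, hk2⟩ := hev.exists
  exact ⟨k, hk2, hk1⟩

/-- Lower bound of `e/(e-1)` for approximating budgeted additive functions by coverage
functions: for every `ε > 0` there are a finite ground set (of size `k²` for a
suitable `k > 0`) and a budgeted additive function `f(S) = min(|S|, k)` on it such
that no coverage function `g` satisfies `f(S) ≤ g(S) ≤ (e/(e-1) - ε)·f(S)` for all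
`S`. -/
theorem budgeted_additive_coverage_lower_bound :
    ∀ ε : ℝ, 0 < ε →
      ∃ (k : ℕ) (f : Finset (Fin (k ^ 2)) → ℝ),
        0 < k ∧
        (∀ S : Finset (Fin (k ^ 2)), f S = min (S.card : ℝ) (k : ℝ)) ∧
        ¬ ∃ g : Finset (Fin (k ^ 2)) → ℝ, IsCoverage g ∧
            ∀ S : Finset (Fin (k ^ 2)),
              f S ≤ g S ∧ g S ≤ (Real.exp 1 / (Real.exp 1 - 1) - ε) * f S := by
  intro ε hε
  obtain ⟨k, hk, hlt⟩ := exists_k (Real.exp 1 / (Real.exp 1 - 1) - ε) (by linarith)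
  refine ⟨k, fun S => min (S.card : ℝ) (k : ℝ), by omega, fun S => rfl, ?_⟩
  rintro ⟨g, hg, h⟩
  exact absurd (key k _ rfl hk _ g hg h) (not_le.2 hlt)
end

section
/- Let a₁, …, a_n be positive integers and let g : ℕ → ℕ be a non-negative, monotone, concave function (i.e. g is non-decreasing and g(j+1) − g(j) is non-increasing in j) with g(0) = 0. Define f : 2^{[n]} → ℤ≥0 by f(S) = g(Σ_{i ∈ S} a_i). Then f can be written as a sum of budgeted additive functions: there exist m ∈ ℕ, non-negative reals α_t and budgets B_t ≥ 0 and values v_{t,i} ≥ 0 for t ∈ [m], i ∈ [n], such that f(S) = Σ_{t=1}^{m} min(B_t, Σ_{i ∈ S} v_{t,i}) for all S ⊆ [n]. -/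
theorem concave_decomp (g : ℕ → ℝ) (hg0 : g 0 = 0) (M : ℕ) : ∀ x : ℕ, x ≤ M + 1 →
    g x = ∑ t ∈ Finset.range M, (2 * g (t + 1) - g t - g (t + 2)) * min ((t : ℝ) + 1) x
      + (g (M + 1) - g M) * x := by
  induction M with
  | zero =>
    intro x hx
    interval_cases x <;> simp [hg0]
  | succ M ih =>
    intro x hx
    rw [Finset.sum_range_succ]
    rcases Nat.lt_or_ge (M + 1) x with h | h
    · obtain rfl : x = M + 1 + 1 := by omega
      have h1 := ih (M + 1) le_rfl
      have h2 : ∑ t ∈ Finset.range M,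
            (2 * g (t + 1) - g t - g (t + 2)) * min ((t : ℝ) + 1) ((M + 1 + 1 : ℕ) : ℝ)
          = ∑ t ∈ Finset.range M,
            (2 * g (t + 1) - g t - g (t + 2)) * min ((t : ℝ) + 1) ((M + 1 : ℕ) : ℝ) := by
        refine Finset.sum_congr rfl fun t ht => ?_
        have ht' : (t : ℝ) < M := by exact_mod_cast Finset.mem_range.1 ht
        push_cast
        rw [min_eq_left (by linarith), min_eq_left (by linarith)]
      rw [h2]
      have h3 : min ((M : ℝ) + 1) ((M + 1 + 1 : ℕ) : ℝ) = M + 1 := by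
        push_cast
        exact min_eq_left (by linarith)
      rw [h3]
      push_cast at h1 ⊢
      linear_combination h1
    · have h1 := ih x h
      have h3 : min ((M : ℝ) + 1) (x : ℝ) = x := min_eq_right (by exact_mod_cast h)
      rw [h3]
      linear_combination h1

/-- Let `a₁, …, a_n` be positive integers and let `g : ℕ → ℕ` be non-decreasing and
concave (successive differences non-increasing) with `g(0) = 0`.  Then the function
`f(S) = g(∑_{i ∈ S} a_i)` is a sum of budgeted additive functions: there are `m ∈ ℕ`,
budgets `B_t ≥ 0` and values `v_{t,i} ≥ 0` with
`f(S) = ∑_{t=1}^m min(B_t, ∑_{i ∈ S} v_{t,i})` for all `S`. -/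
theorem concave_of_additive_is_sum_of_budgeted (n : ℕ) (a : Fin n → ℕ)
    (ha : ∀ i, 0 < a i)
    (g : ℕ → ℕ) (hmono : Monotone g)
    (hconcave : ∀ j : ℕ, g (j + 2) + g j ≤ 2 * g (j + 1))
    (hg0 : g 0 = 0) :
    ∃ (m : ℕ) (B : Fin m → ℝ) (v : Fin m → Fin n → ℝ),
      (∀ t, 0 ≤ B t) ∧ (∀ t i, 0 ≤ v t i) ∧
      ∀ S : Finset (Fin n),
        ((g (∑ i ∈ S, a i) : ℕ) : ℝ) = ∑ t : Fin m, min (B t) (∑ i ∈ S, v t i) := by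
  set M := ∑ i, a i with hM
  let w : ℕ → ℝ := fun t => if t < M then 2 * (g (t + 1) : ℝ) - g t - g (t + 2)
    else (g (t + 1) : ℝ) - g t
  have hw : ∀ t, 0 ≤ w t := by
    intro t
    simp only [w]
    split_ifs
    · have : (g (t + 2) : ℝ) + g t ≤ 2 * g (t + 1) := by exact_mod_cast hconcave t
      linarith
    · have : (g t : ℝ) ≤ g (t + 1) := by exact_mod_cast hmono (Nat.le_succ t)
      linarith
  refine ⟨M + 1, fun t => w t * ((t : ℕ) + 1), fun t i => w t * a i, ?_, ?_, ?_⟩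
  · intro t
    exact mul_nonneg (hw _) (by positivity)
  · intro t i
    exact mul_nonneg (hw _) (by positivity)
  · intro S
    have hS : ∑ i ∈ S, a i ≤ M := Finset.sum_le_univ_sum_of_nonneg (fun _ => Nat.zero_le _)
    have key := concave_decomp (fun k => (g k : ℝ)) (by simp [hg0]) M (∑ i ∈ S, a i) (by omega)
    have e : ∀ t : Fin (M + 1), min (w t * (((t : ℕ) : ℝ) + 1)) (∑ i ∈ S, w t * (a i : ℝ))
        = w t * min (((t : ℕ) : ℝ) + 1) ((∑ i ∈ S, a i : ℕ) : ℝ) := by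
      intro t
      rw [← Finset.mul_sum, mul_min_of_nonneg _ _ (hw _)]
      push_cast
      rfl
    simp only [e]
    rw [Fin.sum_univ_eq_sum_range
      (fun t => w t * min ((t : ℝ) + 1) ((∑ i ∈ S, a i : ℕ) : ℝ)) (M + 1),
      Finset.sum_range_succ]
    have hx : ((∑ i ∈ S, a i : ℕ) : ℝ) ≤ (M : ℝ) + 1 := by
      exact_mod_cast (by omega : ∑ i ∈ S, a i ≤ M + 1)
    rw [min_eq_right hx]
    have hwM : w M = (g (M + 1) : ℝ) - g M := by simp [w]
    rw [hwM]
    refine key.trans ?_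
    congr 1
    refine Finset.sum_congr rfl fun t ht => ?_
    simp only [w, if_pos (Finset.mem_range.1 ht)]
end
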